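/- arXiv:2601.22089 — 5 statements merged into one kernel-verified Lean document; each statement's English description precedes it below -/
import Mathlib

section
/- Let S be a finite set and s : S × S → S × S a bijective map satisfying the RPE, written s(x,y) = (ψ_y(x), y ∘ x). Then for all x', y' ∈ S: {y ∈ S : ψ_y(x') = ψ_{y'}(x')} = {y ∈ S : ψ_y = ψ_{y'}}, and {x ∈ S : y' ∘ x = y' ∘ x'} = {e ∘ x' : e ∈ S, e ∘ e = e}. -/
/-- `s₁₂ = s × id` on `S × S × S`. -/
def pe12 {S : Type*} (s : S × S → S × S) : S × S × S → S × S × S :=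
  fun p => ((s (p.1, p.2.1)).1, (s (p.1, p.2.1)).2, p.2.2)

/-- `s₂₃ = id × s` on `S × S × S`. -/
def pe23 {S : Type*} (s : S × S → S × S) : S × S × S → S × S × S :=
  fun p => (p.1, s p.2)

/-- `s₁₃ = (id × τ) ∘ (s × id) ∘ (id × τ)` on `S × S × S`. -/
def pe13 {S : Type*} (s : S × S → S × S) : S × S × S → S × S × S :=
  fun p => ((s (p.1, p.2.2)).1, p.2.1, (s (p.1, p.2.2)).2)

/-- A map `s : S × S → S × S` satisfies the reversed pentagon equation. -/
def IsRPE {S : Type*} (s : S × S → S × S) : Prop :=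
  pe12 s ∘ pe13 s ∘ pe23 s = pe23 s ∘ pe12 s


/-- A finite bijective pentagon map `(x,y) ↦ (m x y, t x y)` together with its (flipped) inverse
`(v,u) ↦ (m' v u, t' v u)`, which is again a pentagon map. -/
structure PentPair (S : Type*) (m t m' t' : S → S → S) : Prop where
  assoc : ∀ x y z, m (m x y) z = m x (m y z)
  hA : ∀ x y z, t x (m y z) = m (t x y) (t (m x y) z)
  hB : ∀ x y z, t (t x y) (t (m x y) z) = t y z
  assoc' : ∀ x y z, m' (m' x y) z = m' x (m' y z)
  hA' : ∀ x y z, t' x (m' y z) = m' (t' x y) (t' (m' x y) z)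
  hB' : ∀ x y z, t' (t' x y) (t' (m' x y) z) = t' y z
  i1 : ∀ x y, m' (t x y) (m x y) = y
  i2 : ∀ x y, t' (t x y) (m x y) = x
  j1 : ∀ x y, m (t' x y) (m' x y) = y
  j2 : ∀ x y, t (t' x y) (m' x y) = x

namespace PentPair

variable {S : Type*} {m t m' t' : S → S → S}

theorem dual (h : PentPair S m t m' t') : PentPair S m' t' m t :=
  ⟨h.assoc', h.hA', h.hB', h.assoc, h.hA, h.hB, h.j1, h.j2, h.i1, h.i2⟩

theorem of_bij (assoc : ∀ x y z, m (m x y) z = m x (m y z))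
    (hA : ∀ x y z, t x (m y z) = m (t x y) (t (m x y) z))
    (hB : ∀ x y z, t (t x y) (t (m x y) z) = t y z)
    (i1 : ∀ x y, m' (t x y) (m x y) = y)
    (i2 : ∀ x y, t' (t x y) (m x y) = x)
    (j1 : ∀ x y, m (t' x y) (m' x y) = y)
    (j2 : ∀ x y, t (t' x y) (m' x y) = x) : PentPair S m t m' t' := by
  have key : ∀ w q p, ∃ a b c, w = t b c ∧ q = t a (m b c) ∧ p = m a (m b c) := by
    intro w q p
    refine ⟨t' q p, t' w (m' q p), m' w (m' q p), ?_, ?_, ?_⟩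
    · rw [j2]
    · rw [j1, j2]
    · rw [j1, j1]
  have e1 : ∀ a b c, m' (t b c) (t a (m b c)) = t (m a b) c := by
    intro a b c
    rw [hA, ← hB a b c, i1]
  have e2 : ∀ a b c, t' (t b c) (t a (m b c)) = t a b := by
    intro a b c
    rw [hA, ← hB a b c, i2]
  refine ⟨assoc, hA, hB, ?_, ?_, ?_, i1, i2, j1, j2⟩
  · intro w q p
    obtain ⟨a, b, c, rfl, rfl, rfl⟩ := key w q p
    rw [e1, i1, i1, ← assoc, i1]
  · intro w q p
    obtain ⟨a, b, c, rfl, rfl, rfl⟩ := key w q p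
    rw [e1, e2, i1, i2, ← assoc, i2, i1]
  · intro w q p
    obtain ⟨a, b, c, rfl, rfl, rfl⟩ := key w q p
    rw [e1, e2, i2, ← assoc, i2, i2]

theorem ext2 (h : PentPair S m t m' t') {x y x' y' : S} (h1 : m x y = m x' y')
    (h2 : t x y = t x' y') : x = x' ∧ y = y' := by
  constructor
  · rw [← h.i2 x y, h1, h2, h.i2]
  · rw [← h.i1 x y, h1, h2, h.i1]

theorem idem (h : PentPair S m t m' t') [Finite S] (M : Set S) (hM : M.Nonempty)
    (hc : ∀ x ∈ M, ∀ y ∈ M, m x y ∈ M) : ∃ e ∈ M, m e e = e := by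
  letI : Semigroup S := { mul := m, mul_assoc := h.assoc }
  letI : TopologicalSpace S := ⊥
  haveI : DiscreteTopology S := ⟨rfl⟩
  exact exists_idempotent_in_compact_subsemigroup (fun r => continuous_of_discreteTopology) M hM
    (Set.toFinite M).isCompact hc

theorem univ_of_closed (h : PentPair S m t m' t') [Finite S] (M : Set S) (hM : M.Nonempty)
    (h1 : ∀ x, ∀ y ∈ M, m x y ∈ M) (h2 : ∀ x, ∀ y ∈ M, t x y ∈ M) : ∀ x, x ∈ M := by
  have hinj : Function.Injective
      (fun p : S × M => ((⟨m p.1 p.2, h1 _ _ p.2.2⟩, ⟨t p.1 p.2, h2 _ _ p.2.2⟩) : M × M)) := by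
    rintro ⟨x, y, hy⟩ ⟨x', y', hy'⟩ hh
    simp only [Prod.mk.injEq, Subtype.mk.injEq] at hh
    obtain ⟨rfl, rfl⟩ := h.ext2 hh.1 hh.2
    rfl
  have hcard := Nat.card_le_card_of_injective _ hinj
  rw [Nat.card_prod, Nat.card_prod] at hcard
  haveI : Nonempty M := hM.to_subtype
  have hle : Nat.card S ≤ Nat.card M := Nat.le_of_mul_le_mul_right hcard Nat.card_pos
  have hMS : M = Set.univ := by
    apply Set.eq_of_subset_of_ncard_le (Set.subset_univ _)
    rw [Set.ncard_univ]
    exact hle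
  intro x
  rw [hMS]
  trivial

theorem range_right (h : PentPair S m t m' t') [Finite S] (c x y : S)
    (hx : x ∈ Set.range (t c)) : m x y ∈ Set.range (t c) := by
  have hback : ∀ v, ∀ u ∈ Set.range (t c), t' v u ∈ Set.range (t c) := by
    rintro v _ ⟨d, rfl⟩
    have h1 := h.hB' v (t c d) (m c d)
    rw [h.i2] at h1
    have h2 := h.j2 (t' v (t c d)) (t' (m' v (t c d)) (m c d))
    rw [h1] at h2
    exact ⟨_, h2⟩
  have hinj : Function.Injective
      (fun p : Set.range (t c) × S =>
        ((⟨t' p.2 p.1, hback _ _ p.1.2⟩, m' p.2 p.1) : Set.range (t c) × S)) := by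
    rintro ⟨⟨x, hx⟩, y⟩ ⟨⟨x', hx'⟩, y'⟩ hh
    simp only [Prod.mk.injEq, Subtype.mk.injEq] at hh
    obtain ⟨rfl, rfl⟩ := h.dual.ext2 hh.2 hh.1
    rfl
  obtain ⟨⟨⟨u, hu⟩, v⟩, hp⟩ := Finite.surjective_of_injective hinj (⟨x, hx⟩, y)
  simp only [Prod.mk.injEq, Subtype.mk.injEq] at hp
  rw [← hp.1, ← hp.2, h.j1]
  exact hu

theorem t_inj (h : PentPair S m t m' t') [Finite S] (x : S) : Function.Injective (t x) := by
  obtain ⟨e, -, he⟩ := h.idem Set.univ ⟨x, trivial⟩ (fun _ _ _ _ => trivial)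
  have hff : m (t e e) (t e e) = t e e := by
    have := h.hA e e e
    rw [he] at this
    exact this.symm
  have hfix : ∀ z ∈ Set.range (t e), t (t e e) z = z := by
    rintro _ ⟨z, rfl⟩
    have := h.hB e e z
    rwa [he] at this
  have hf : Function.Injective (t (t e e)) := by
    set f := t e e with hfdef
    intro a b hab
    have h3 : t f (m f a) = t f (m f b) := by
      rw [h.hA, h.hA, hff, hab]
    have hr : f ∈ Set.range (t e) := ⟨e, rfl⟩
    rw [hfix _ (h.range_right e f a hr), hfix _ (h.range_right e f b hr)] at h3
    exact (h.ext2 h3 hab).2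
  refine h.univ_of_closed {y | Function.Injective (t y)} ⟨_, hf⟩ ?_ ?_ x
  · intro x y hy a b hab
    apply hy
    rw [← h.hB x y a, ← h.hB x y b, hab]
  · intro x y hy
    have hcomp : Function.Injective (t (t x y) ∘ t (m x y)) := by
      intro a b hab
      apply hy
      simpa [h.hB] using hab
    have h1 : Function.Injective (t (m x y)) := hcomp.of_comp
    have h2 := Finite.surjective_of_injective h1
    exact hcomp.of_comp_right h2

theorem hom' (h : PentPair S m t m' t') (x y z : S) : t' x (t' y z) = t' (m x y) z := by
  have := h.hB' (t x y) (m x y) z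
  rwa [h.i1, h.i2] at this

/-- The set of elements acting trivially. -/
def E0 (t' : S → S → S) : Set S := {x | ∀ u, t' x u = u}

theorem idem_mem (h : PentPair S m t m' t') [Finite S] {e : S} (he : m e e = e) :
    e ∈ E0 t' := by
  intro u
  apply h.dual.t_inj e
  rw [h.hom', he]

theorem mem_E0_of_mul (h : PentPair S m t m' t') [Finite S] {x g : S} (hx : m x g = x) :
    g ∈ E0 t' := by
  intro u
  apply h.dual.t_inj x
  rw [h.hom', hx]

theorem mul_of_t_mem (h : PentPair S m t m' t') {x g : S} (hg : t x g ∈ E0 t') :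
    m x g = x := by
  have := h.i2 x g
  rwa [hg] at this

theorem t_mem (h : PentPair S m t m' t') [Finite S] (x g : S) :
    g ∈ E0 t' → t x g ∈ E0 t' := by
  have hbij : Function.Bijective (t x) := Finite.injective_iff_bijective.1 (h.t_inj x)
  let F := Equiv.ofBijective _ hbij
  have hF : ∀ z ∈ E0 t', F.symm z ∈ E0 t' := by
    intro z hz
    apply h.mem_E0_of_mul (x := x)
    apply h.mul_of_t_mem
    change F (F.symm z) ∈ E0 t'
    rwa [F.apply_symm_apply]
  intro hg
  have hinj : Function.Injective (fun z : E0 t' => (⟨F.symm z, hF _ z.2⟩ : E0 t')) := by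
    intro a b hab
    simp only [Subtype.mk.injEq] at hab
    exact Subtype.ext (F.symm.injective hab)
  obtain ⟨⟨z, hz⟩, hzg⟩ := Finite.surjective_of_injective hinj ⟨g, hg⟩
  simp only [Subtype.mk.injEq] at hzg
  rw [← hzg]
  change F (F.symm z) ∈ E0 t'
  rwa [F.apply_symm_apply]

theorem mul_E0 (h : PentPair S m t m' t') [Finite S] (x : S) {g : S} (hg : g ∈ E0 t') :
    m x g = x := h.mul_of_t_mem (h.t_mem x g hg)

theorem cancel (h : PentPair S m t m' t') [Finite S] (x : S) :
    Function.Injective (fun y => m y x) := by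
  intro y y' hy
  have hy : m y x = m y' x := hy
  obtain ⟨_, ⟨z, rfl⟩, he⟩ := h.idem (Set.range (m x)) ⟨_, x, rfl⟩ (by
    rintro _ ⟨a, rfl⟩ _ ⟨b, rfl⟩
    exact ⟨m a (m x b), (h.assoc _ _ _).symm⟩)
  have h0 := h.idem_mem he
  rw [← h.mul_E0 y h0, ← h.mul_E0 y' h0, ← h.assoc, ← h.assoc, hy]

theorem fiber (h : PentPair S m t m' t') [Finite S] (y' x x' : S) :
    m y' x = m y' x' ↔ ∃ e, m e e = e ∧ x = m e x' := by
  constructor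
  · intro hx
    obtain ⟨z, hz⟩ := Finite.surjective_of_injective (h.cancel x') x
    have hz : m z x' = x := hz
    refine ⟨z, ?_, hz.symm⟩
    apply h.mul_E0
    apply h.mem_E0_of_mul (x := y')
    apply h.cancel x'
    change m (m y' z) x' = m y' x'
    rw [h.assoc, hz, hx]
  · rintro ⟨e, he, rfl⟩
    rw [← h.assoc, h.mul_E0 _ (h.idem_mem he)]

theorem fiber_t (h : PentPair S m t m' t') [Finite S] {x y y' : S} (hx : t y x = t y' x) :
    t y = t y' := by
  have h1 : m' (t y x) (m y x) = m' (t y x) (m y' x) := by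
    rw [h.i1]
    rw [hx, h.i1]
  obtain ⟨e, he, hu⟩ := (h.dual.fiber _ _ _).1 h1
  have h0 := h.dual.idem_mem he
  have hv := h.dual.t_mem (t y x) e h0
  have h2 := h.hA' (t y x) e (m y' x)
  rw [← hu, h.i2, h.dual.mul_E0 _ h0] at h2
  rw [hx, h.i2, ← hx] at h2
  funext z
  rw [h2, ← h.dual.hom', hv]

end PentPair

/-- Let `S` be a finite set and `s` a bijective solution of the RPE, written
`s(x,y) = (ψ_y(x), y ∘ x)`.  Then for all `x', y' ∈ S`:
`{y : ψ_y(x') = ψ_{y'}(x')} = {y : ψ_y = ψ_{y'}}` and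
`{x : y' ∘ x = y' ∘ x'} = {e ∘ x' : e idempotent}`. -/
theorem fibers_of_finite_bijective_RPE {S : Type*} [Finite S]
    (s : S × S → S × S) (hbij : Function.Bijective s) (hRPE : IsRPE s)
    (ψ o : S → S → S) (hs : ∀ x y : S, s (x, y) = (ψ y x, o y x)) :
    ∀ x' y' : S,
      ({y : S | ψ y x' = ψ y' x'} = {y : S | ψ y = ψ y'}) ∧
      ({x : S | o y' x = o y' x'} = {x : S | ∃ e : S, o e e = e ∧ x = o e x'}) := by
  have hk : ∀ x y z, (ψ (ψ z y) (ψ (o z y) x) = ψ y x) ∧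
      o (ψ z y) (ψ (o z y) x) = ψ z (o y x) ∧ o (o z y) x = o z (o y x) := by
    intro x y z
    have := congrFun hRPE (x, y, z)
    simpa [pe12, pe13, pe23, hs] using this
  let F := Equiv.ofBijective s hbij
  have hF : ∀ p, F p = s p := fun p => rfl
  have h : PentPair S o ψ (fun v u => (F.symm (v, u)).1) (fun v u => (F.symm (v, u)).2) := by
    apply PentPair.of_bij
    · intro x y z
      exact (hk z y x).2.2
    · intro x y z
      exact (hk z y x).2.1.symm
    · intro x y z
      exact (hk z y x).1
    · intro x y
      rw [← hs, ← hF, F.symm_apply_apply]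
    · intro x y
      rw [← hs, ← hF, F.symm_apply_apply]
    · intro x y
      have := hs (F.symm (x, y)).1 (F.symm (x, y)).2
      rw [← hF, Prod.mk.eta, F.apply_symm_apply] at this
      exact (Prod.ext_iff.1 this).2.symm
    · intro x y
      have := hs (F.symm (x, y)).1 (F.symm (x, y)).2
      rw [← hF, Prod.mk.eta, F.apply_symm_apply] at this
      exact (Prod.ext_iff.1 this).1.symm
  intro x' y'
  constructor
  · ext y
    exact ⟨fun hy => h.fiber_t hy, fun hy => congrFun hy x'⟩
  · ext x
    exact h.fiber y' x x'
end

section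
/- Let S be a finite set and s : S × S → S × S a bijective map satisfying the RPE, written s(x,y) = (ψ_y(x), y ∘ x), and let E = {e ∈ S : e ∘ e = e} be the set of idempotents of (S, ∘). Then for all e, f ∈ E, the sets {a ∈ E : ψ_a = ψ_e} and {a ∈ E : ψ_a = ψ_f} have the same cardinality. -/
/-- In a finite associative structure, every element has a commuting partner whose product with
it is idempotent. -/
theorem exists_idem_pow {S : Type*} [Finite S] (o : S → S → S)
    (A : ∀ x y z, o (o x y) z = o x (o y z)) (x : S) :
    ∃ w, o x w = o w x ∧ o (o x w) (o x w) = o x w := by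
  let P : ℕ → S := fun n => (o x)^[n] x
  have hP0 : P 0 = x := rfl
  have hPs : ∀ n, P (n + 1) = o x (P n) := fun n => Function.iterate_succ_apply' _ _ _
  have hadd : ∀ a b, o (P a) (P b) = P (a + b + 1) := by
    intro a b
    induction a with
    | zero => rw [hP0, ← hPs]; congr 1; omega
    | succ a ih => rw [hPs, A, ih, ← hPs]; congr 1; omega
  obtain ⟨m, n, hne, hmn⟩ := Finite.exists_ne_map_eq_of_infinite P
  obtain ⟨m, k, hk, hmk⟩ : ∃ m k, 0 < k ∧ P (m + k) = P m := by
    rcases Nat.lt_or_gt_of_ne hne with h | h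
    · exact ⟨m, n - m, by omega, by rw [hmn]; congr 1; omega⟩
    · exact ⟨n, m - n, by omega, by rw [← hmn]; congr 1; omega⟩
  have h1 : ∀ j, P (m + j + k) = P (m + j) := by
    intro j
    induction j with
    | zero => simpa using hmk
    | succ j ih =>
      have e1 : m + (j + 1) + k = (m + j + k) + 1 := by omega
      have e2 : m + (j + 1) = (m + j) + 1 := by omega
      rw [e1, e2, hPs, hPs, ih]
  have h2 : ∀ a j, P (m + j + a * k) = P (m + j) := by
    intro a j
    induction a with
    | zero => simp
    | succ a ih =>
      have e1 : m + j + (a + 1) * k = m + (j + a * k) + k := by ring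
      rw [e1, h1, ← ih]; congr 1; ring
  obtain ⟨j, hj⟩ : ∃ j, m + j + 1 = (m + 1) * k := by
    have : m + 1 ≤ (m + 1) * k := Nat.le_mul_of_pos_right _ hk
    exact ⟨(m + 1) * k - (m + 1), by omega⟩
  have hid : o (P (m + j)) (P (m + j)) = P (m + j) := by
    rw [hadd, ← h2 (m + 1) j, ← hj]; congr 1
  have hw : o x (P (2 * (m + j))) = P (m + j) := by
    rw [← hPs, ← hid, hadd]; congr 1; omega
  have hw' : o (P (2 * (m + j))) x = P (m + j) := by
    have := hadd (2 * (m + j)) 0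
    rw [hP0] at this
    rw [this, ← hid, hadd]; congr 1; omega
  exact ⟨P (2 * (m + j)), by rw [hw, hw'], by rw [hw, hid]⟩

/-- Let `S` be a finite set, `s` a bijective solution of the RPE written
`s(x,y) = (ψ_y(x), y ∘ x)`, and `E = {e : e ∘ e = e}` the idempotents.  Then for all
`e, f ∈ E` the sets `{a ∈ E : ψ_a = ψ_e}` and `{a ∈ E : ψ_a = ψ_f}` have the same
cardinality. -/
theorem retract_classes_equal_cardinality {S : Type*} [Finite S]
    (s : S × S → S × S) (hbij : Function.Bijective s) (hRPE : IsRPE s)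
    (ψ o : S → S → S) (hs : ∀ x y : S, s (x, y) = (ψ y x, o y x)) :
    ∀ e f : S, o e e = e → o f f = f →
      Nat.card {a : S // o a a = a ∧ ψ a = ψ e} =
        Nat.card {a : S // o a a = a ∧ ψ a = ψ f} := by
  have key : ∀ x y z : S,
      (ψ (ψ x y) (ψ (o x y) z) = ψ y z ∧ o (ψ x y) (ψ (o x y) z) = ψ x (o y z)) ∧
        o (o x y) z = o x (o y z) := by
    intro x y z
    have h := congrFun hRPE (z, y, x)
    simp only [Function.comp, pe12, pe13, pe23, hs, Prod.mk.injEq] at h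
    exact ⟨⟨h.1, h.2.1⟩, h.2.2⟩
  have A : ∀ x y z, o (o x y) z = o x (o y z) := fun x y z => (key x y z).2
  have B : ∀ x y z, ψ (ψ x y) (ψ (o x y) z) = ψ y z := fun x y z => (key x y z).1.1
  have C : ∀ x y z, ψ x (o y z) = o (ψ x y) (ψ (o x y) z) := fun x y z => (key x y z).1.2.symm
  have inj : ∀ x y x' y', o x y = o x' y' → ψ x y = ψ x' y' → x = x' ∧ y = y' := by
    intro x y x' y' h1 h2
    have := @hbij.1 (y, x) (y', x') (by rw [hs, hs, h1, h2])
    simp only [Prod.mk.injEq] at this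
    exact ⟨this.2, this.1⟩
  have sur : ∀ w t, ∃ x y, o x y = w ∧ ψ x y = t := by
    intro w t
    obtain ⟨⟨y, x⟩, h⟩ := hbij.2 (t, w)
    rw [hs, Prod.mk.injEq] at h
    exact ⟨x, y, h.2, h.1⟩
  -- right ideals of the form `{z | e z = z}` are detected on left factors
  have F : ∀ e x y, o e (o x y) = o x y → o e x = x := by
    intro e x y h
    let g : {p : S × S // o e p.1 = p.1} → {p : S × S // o e p.1 = p.1} :=
      fun p => ⟨(o p.1.1 p.1.2, ψ p.1.1 p.1.2), by
        change o e (o p.1.1 p.1.2) = o p.1.1 p.1.2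
        rw [← A, p.2]⟩
    have hg : Function.Injective g := by
      rintro ⟨⟨a, b⟩, hp⟩ ⟨⟨a', b'⟩, hq⟩ hpq
      simp only [g, Subtype.mk.injEq, Prod.mk.injEq] at hpq
      obtain ⟨h1, h2⟩ := inj _ _ _ _ hpq.1 hpq.2
      subst h1 h2
      rfl
    obtain ⟨⟨⟨a, b⟩, hp⟩, hab⟩ := (Finite.injective_iff_surjective.1 hg) ⟨(o x y, ψ x y), h⟩
    simp only [g, Subtype.mk.injEq, Prod.mk.injEq] at hab
    obtain ⟨h1, h2⟩ := inj _ _ _ _ hab.1 hab.2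
    subst h1
    exact hp
  have St : ∀ e, o e e = e → ∀ t, ∃ y, o (ψ e y) t = ψ e e := by
    intro e he t
    obtain ⟨x, y, h1, h2⟩ := sur e t
    have hx : o e x = x := F e x y (by rw [h1, he])
    refine ⟨x, ?_⟩
    have := C e x y
    rw [h1, hx, h2] at this
    exact this.symm
  intro e₀ f₀ he₀ hf₀
  obtain ⟨d, hd⟩ : ∃ d, d = ψ e₀ e₀ := ⟨_, rfl⟩
  have hdd : o d d = d := by
    have := C e₀ e₀ e₀
    rw [he₀] at this
    rw [hd, ← this]
  have hdt : ∀ t, o t t = t → o d t = d := by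
    intro t ht
    obtain ⟨a, ha⟩ := St e₀ he₀ t
    rw [hd, ← ha, A, ht]
  have htd : ∀ t, o t t = t → o t d = t := by
    intro t ht
    have h1 : o (o t d) (o t d) = o t d := by
      rw [A, ← A d t d, hdt t ht, hdd]
    have h2 := F _ _ _ h1
    rw [A, hdt t ht] at h2
    exact h2
  have LZ : ∀ t u, o t t = t → o u u = u → o t u = t := by
    intro t u ht hu
    rw [← htd t ht, A, hdt u hu]
  have RI : ∀ x u, o u u = u → o x u = x := by
    intro x u hu
    obtain ⟨w, hw, hid⟩ := exists_idem_pow o A x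
    have h1 : o (o x w) x = x := F _ _ _ hid
    have h2 : o x (o x w) = x := by rw [hw, ← A, h1]
    calc o x u = o (o x (o x w)) u := by rw [h2]
      _ = x := by rw [A, LZ _ _ hid hu, h2]
  have Eid : ∀ e f, o e e = e → o f f = f → o (ψ e f) (ψ e f) = ψ e f := by
    intro e f he hf
    have := C e f f
    rw [hf, RI e f hf] at this
    exact this.symm
  have Einj : ∀ e f g, o e e = e → o f f = f → o g g = g → ψ e f = ψ e g → f = g := by
    intro e f g he hf hg h
    exact (inj e f e g (by rw [RI e f hf, RI e g hg]) h).2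
  have hd1 : ∀ z, ψ d (ψ e₀ z) = ψ e₀ z := by
    intro z
    have := B e₀ e₀ z
    rwa [he₀, ← hd] at this
  have hd2 : ψ d d = d := by
    have := hd1 e₀
    rwa [← hd] at this
  have hd3 : ∀ z, ψ d (ψ d z) = ψ d z := by
    intro z
    have := B d d z
    rwa [hd2, hdd] at this
  have hdE : ∀ f, o f f = f → ψ d f = f := fun f hf =>
    Einj d _ _ hdd (Eid d f hdd hf) hf (hd3 f)
  have hds : ∀ t, ∃ x, ψ d x = t := by
    intro t
    obtain ⟨w, hw, hid⟩ := exists_idem_pow o A t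
    obtain ⟨y, hy⟩ := St d hdd w
    rw [hd2] at hy
    have hid' : o (o w t) (o w t) = o w t := by rw [← hw]; exact hid
    have h1 : ψ d y = o d t := by
      have h := congrArg (fun u => o u t) hy
      simp only [A] at h
      rwa [RI _ _ hid'] at h
    refine ⟨o (o t w) y, ?_⟩
    rw [C, RI d _ hid, hdE _ hid, h1, ← A, RI _ d hdd]
    exact F _ _ _ hid
  have hdid : ∀ z, ψ d z = z := by
    intro z
    obtain ⟨x, rfl⟩ := hds z
    exact hd3 x
  have surj : ∀ f, o f f = f → Function.Surjective (ψ f) := by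
    intro f hf
    have hinj : Function.Injective (ψ f) := by
      apply Function.LeftInverse.injective (g := ψ (ψ f d))
      intro z
      have := B f d z
      rwa [RI f d hdd, hdid] at this
    exact Finite.injective_iff_surjective.1 hinj
  have main : ∀ e, o e e = e → Nat.card {a : S // o a a = a ∧ ψ a = ψ e} =
      Nat.card {a : S // o a a = a ∧ ψ a = id} := by
    intro e he
    let g : {a : S // o a a = a ∧ ψ a = ψ e} → {a : S // o a a = a ∧ ψ a = id} :=
      fun a => ⟨ψ e a.1, Eid e a.1 he a.2.1, by
        funext z
        obtain ⟨y, rfl⟩ := surj e he z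
        have := B e a.1 y
        rw [RI e _ a.2.1, a.2.2] at this
        exact this⟩
    refine Nat.card_eq_of_bijective g ⟨?_, ?_⟩
    · rintro ⟨a, ha⟩ ⟨b, hb⟩ hab
      simp only [g, Subtype.mk.injEq] at hab
      exact Subtype.ext (Einj e a b he ha.1 hb.1 hab)
    · rintro ⟨b, hb, hb'⟩
      let k : {a : S // o a a = a} → {a : S // o a a = a} :=
        fun a => ⟨ψ e a.1, Eid e a.1 he a.2⟩
      have hk : Function.Injective k := by
        rintro ⟨a, ha⟩ ⟨c, hc⟩ hac
        simp only [k, Subtype.mk.injEq] at hac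
        exact Subtype.ext (Einj e a c he ha hc hac)
      obtain ⟨⟨a, ha⟩, hab⟩ := (Finite.injective_iff_surjective.1 hk) ⟨b, hb⟩
      simp only [k, Subtype.mk.injEq] at hab
      refine ⟨⟨a, ha, ?_⟩, Subtype.ext hab⟩
      funext z
      have := B e a z
      rw [RI e _ ha, hab, hb'] at this
      exact this.symm
  rw [main e₀ he₀, main f₀ hf₀]
end

section
/- Let S be a set and s : S × S → S × S a bijective map satisfying the RPE, and set t := τ ∘ s⁻¹ ∘ τ, where τ(x,y) = (y,x). Then s is commutative, i.e. s₁₃ ∘ s₂₃ = s₂₃ ∘ s₁₃ as maps on S × S × S, if and only if t is cocommutative, i.e. t₁₂ ∘ t₁₃ = t₁₃ ∘ t₁₂ as maps on S × S × S. -/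
/-- Reversal of the three tensor legs. -/
def legRev {S : Type*} : S × S × S → S × S × S := fun p => (p.2.2, p.2.1, p.1)

theorem pe12_dual {S : Type*} (f : S × S → S × S) (p : S × S × S) :
    pe12 (Prod.swap ∘ f ∘ Prod.swap) p = legRev (pe23 f (legRev p)) := rfl

theorem pe13_dual {S : Type*} (f : S × S → S × S) (p : S × S × S) :
    pe13 (Prod.swap ∘ f ∘ Prod.swap) p = legRev (pe13 f (legRev p)) := rfl

theorem legRev_legRev {S : Type*} (p : S × S × S) : legRev (legRev p) = p := rfl

theorem pe23_leftInverse {S : Type*} {f g : S × S → S × S} (h : Function.LeftInverse g f)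
    (p : S × S × S) : pe23 g (pe23 f p) = p := by
  simp [pe23, h _]

theorem pe13_leftInverse {S : Type*} {f g : S × S → S × S} (h : Function.LeftInverse g f)
    (p : S × S × S) : pe13 g (pe13 f p) = p := by
  simp [pe13, h _]

/-- Inverses of commuting maps commute. -/
theorem comm_of_inverse {S : Type*} {f g : S × S → S × S} (h : Function.LeftInverse g f)
    (h' : Function.LeftInverse f g) (hc : ∀ p, pe13 f (pe23 f p) = pe23 f (pe13 f p))
    (p : S × S × S) : pe23 g (pe13 g p) = pe13 g (pe23 g p) := by
  have key := hc (pe23 g (pe13 g p))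
  rw [pe23_leftInverse h', pe13_leftInverse h'] at key
  conv_rhs => rw [key, pe23_leftInverse h, pe13_leftInverse h]

/-- Let `s` be a bijective RPE solution with inverse `sinv`, and `t := τ ∘ s⁻¹ ∘ τ`.
Then `s` is commutative (`s₁₃ ∘ s₂₃ = s₂₃ ∘ s₁₃`) if and only if `t` is cocommutative
(`t₁₂ ∘ t₁₃ = t₁₃ ∘ t₁₂`). -/
theorem commutative_iff_dual_cocommutative {S : Type*}
    (s sinv : S × S → S × S)
    (hli : Function.LeftInverse sinv s) (hri : Function.RightInverse sinv s)
    (hRPE : IsRPE s) :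
    (pe13 s ∘ pe23 s = pe23 s ∘ pe13 s) ↔
      (pe12 (Prod.swap ∘ sinv ∘ Prod.swap) ∘ pe13 (Prod.swap ∘ sinv ∘ Prod.swap) =
        pe13 (Prod.swap ∘ sinv ∘ Prod.swap) ∘ pe12 (Prod.swap ∘ sinv ∘ Prod.swap)) := by
  constructor
  · intro hc
    funext p
    simp only [Function.comp_apply (f := pe12 _), Function.comp_apply (f := pe13 _),
      pe12_dual, pe13_dual, legRev_legRev]
    rw [comm_of_inverse hli hri (fun q => congrFun hc q)]
  · intro hc
    have hc' : ∀ q, pe13 sinv (pe23 sinv q) = pe23 sinv (pe13 sinv q) := fun q =>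
      (congrArg legRev (congrFun hc (legRev q))).symm
    funext p
    exact (comm_of_inverse hri hli hc' p).symm
end

section
/- Let k be a field and H a bialgebra over k. Then Φ_H satisfies (Φ_H)₁₂ ∘ (Φ_H)₁₃ = (Φ_H)₁₃ ∘ (Φ_H)₁₂ as k-linear endomorphisms of H ⊗ H ⊗ H if and only if H is cocommutative, i.e. τ ∘ Δ = Δ where τ : H ⊗ H → H ⊗ H is the flip. -/
open TensorProduct

/-- The canonical RPE operator `Φ_H = (id ⊗ m) ∘ (Δ ⊗ id)` of a bialgebra,
in Sweedler notation `a ⊗ b ↦ a₍₁₎ ⊗ a₍₂₎b`. -/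
noncomputable def PhiBialg (k H : Type*) [CommRing k] [Ring H] [Bialgebra k H] :
    H ⊗[k] H →ₗ[k] H ⊗[k] H :=
  (TensorProduct.map LinearMap.id (LinearMap.mul' k H)) ∘ₗ
    (TensorProduct.assoc k H H H).toLinearMap ∘ₗ
      (TensorProduct.map Coalgebra.comul LinearMap.id)

/-- `f₁₂ = f ⊗ id`, read through the associativity isomorphism. -/
noncomputable def lmap12 (k V : Type*) [CommRing k] [AddCommGroup V] [Module k V]
    (f : V ⊗[k] V →ₗ[k] V ⊗[k] V) : V ⊗[k] (V ⊗[k] V) →ₗ[k] V ⊗[k] (V ⊗[k] V) :=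
  (TensorProduct.assoc k V V V).toLinearMap ∘ₗ (TensorProduct.map f LinearMap.id) ∘ₗ
    (TensorProduct.assoc k V V V).symm.toLinearMap

/-- `f₁₃ = (id ⊗ τ) ∘ (f ⊗ id) ∘ (id ⊗ τ)` with `τ` the flip. -/
noncomputable def lmap13 (k V : Type*) [CommRing k] [AddCommGroup V] [Module k V]
    (f : V ⊗[k] V →ₗ[k] V ⊗[k] V) : V ⊗[k] (V ⊗[k] V) →ₗ[k] V ⊗[k] (V ⊗[k] V) :=
  (TensorProduct.map LinearMap.id (TensorProduct.comm k V V).toLinearMap) ∘ₗ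
    lmap12 k V f ∘ₗ
      (TensorProduct.map LinearMap.id (TensorProduct.comm k V V).toLinearMap)

/-- `w ↦ (w * y) ⊗ z`. -/
noncomputable def auxT (k : Type*) {H : Type*} [CommRing k] [Ring H] [Algebra k H] (y z : H) :
    H →ₗ[k] H ⊗[k] H :=
  (TensorProduct.mk k H H).flip z ∘ₗ LinearMap.mulRight k y

/-- `w ↦ y ⊗ (w * z)`. -/
noncomputable def auxS (k : Type*) {H : Type*} [CommRing k] [Ring H] [Algebra k H] (y z : H) :
    H →ₗ[k] H ⊗[k] H :=
  TensorProduct.mk k H H y ∘ₗ LinearMap.mulRight k z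

/-- `v ⊗ w ↦ (v * b) ⊗ (w * c)`. -/
noncomputable def auxR (k : Type*) {H : Type*} [CommRing k] [Ring H] [Algebra k H] (b c : H) :
    H ⊗[k] H →ₗ[k] H ⊗[k] H :=
  TensorProduct.map (LinearMap.mulRight k b) (LinearMap.mulRight k c)

section aux
variable {k H : Type*} [CommRing k] [Ring H] [Bialgebra k H]

theorem aux12 (x y z : H) :
    lmap12 k H (PhiBialg k H) (x ⊗ₜ (y ⊗ₜ z)) =
      TensorProduct.map LinearMap.id (auxT k y z) (Coalgebra.comul x) := by
  simp only [lmap12, PhiBialg, LinearMap.comp_apply, LinearEquiv.coe_coe,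
    TensorProduct.assoc_symm_tmul, TensorProduct.map_tmul, LinearMap.id_apply]
  generalize (Coalgebra.comul x : H ⊗[k] H) = t
  induction t with
  | zero => simp
  | tmul p q => simp [auxT]
  | add s t hs ht => simp only [TensorProduct.add_tmul, map_add, hs, ht]

theorem aux13 (x y z : H) :
    lmap13 k H (PhiBialg k H) (x ⊗ₜ (y ⊗ₜ z)) =
      TensorProduct.map LinearMap.id (auxS k y z) (Coalgebra.comul x) := by
  simp only [lmap13, LinearMap.comp_apply, LinearEquiv.coe_coe,
    TensorProduct.map_tmul, LinearMap.id_apply, TensorProduct.comm_tmul, aux12]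
  generalize (Coalgebra.comul x : H ⊗[k] H) = t
  induction t with
  | zero => simp
  | tmul p q => simp [auxT, auxS]
  | add s t hs ht => simp only [map_add, hs, ht]

theorem aux_coassoc (a : H) :
    TensorProduct.assoc k H H H (TensorProduct.map Coalgebra.comul LinearMap.id
      (Coalgebra.comul (R := k) a)) =
    TensorProduct.map LinearMap.id Coalgebra.comul (Coalgebra.comul (R := k) a) :=
  Coalgebra.coassoc_apply a

theorem aux_left (a b c : H) :
    lmap12 k H (PhiBialg k H) (lmap13 k H (PhiBialg k H) (a ⊗ₜ (b ⊗ₜ c))) =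
      TensorProduct.map LinearMap.id (auxR k b c)
        (TensorProduct.map LinearMap.id Coalgebra.comul (Coalgebra.comul (R := k) a)) := by
  rw [aux13, ← aux_coassoc]
  generalize (Coalgebra.comul a : H ⊗[k] H) = t
  induction t with
  | zero => simp
  | add s t hs ht => simp only [map_add, hs, ht]
  | tmul x w =>
    simp only [TensorProduct.map_tmul, auxS, LinearMap.comp_apply, TensorProduct.mk_apply,
      LinearMap.mulRight_apply, LinearMap.id_apply, aux12]
    generalize (Coalgebra.comul x : H ⊗[k] H) = t
    induction t with
    | zero => simp
    | tmul p q => simp [auxT, auxR]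
    | add s t hs ht => simp only [TensorProduct.add_tmul, map_add, hs, ht]

theorem aux_right (a b c : H) :
    lmap13 k H (PhiBialg k H) (lmap12 k H (PhiBialg k H) (a ⊗ₜ (b ⊗ₜ c))) =
      TensorProduct.map LinearMap.id (auxR k b c ∘ₗ (TensorProduct.comm k H H).toLinearMap)
        (TensorProduct.map LinearMap.id Coalgebra.comul (Coalgebra.comul (R := k) a)) := by
  rw [aux12, ← aux_coassoc]
  generalize (Coalgebra.comul a : H ⊗[k] H) = t
  induction t with
  | zero => simp
  | add s t hs ht => simp only [map_add, hs, ht]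
  | tmul x w =>
    simp only [TensorProduct.map_tmul, auxT, LinearMap.comp_apply, TensorProduct.mk_apply,
      LinearMap.flip_apply, LinearMap.mulRight_apply, LinearMap.id_apply, aux13]
    generalize (Coalgebra.comul x : H ⊗[k] H) = t
    induction t with
    | zero => simp
    | tmul p q => simp [auxS, auxR]
    | add s t hs ht => simp only [TensorProduct.add_tmul, map_add, hs, ht]

theorem aux_counit (f : H →ₗ[k] H ⊗[k] H) (a : H) :
    TensorProduct.lid k (H ⊗[k] H) (TensorProduct.map (Coalgebra.counit (R := k)) LinearMap.id
      (TensorProduct.map LinearMap.id f (Coalgebra.comul (R := k) a))) = f a := by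
  have h : ∀ t : H ⊗[k] H, TensorProduct.lid k (H ⊗[k] H)
      (TensorProduct.map (Coalgebra.counit (R := k)) LinearMap.id
      (TensorProduct.map LinearMap.id f t)) =
      f (TensorProduct.lid k H (LinearMap.rTensor H (Coalgebra.counit (R := k)) t)) := by
    intro t
    induction t with
    | zero => simp
    | tmul p q => simp
    | add s t hs ht => simp only [map_add, hs, ht]
  rw [h, Coalgebra.rTensor_counit_comul]
  simp

theorem aux_map_comp (g : H ⊗[k] H →ₗ[k] H ⊗[k] H) (f : H →ₗ[k] H ⊗[k] H) (t : H ⊗[k] H) :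
    TensorProduct.map (LinearMap.id : H →ₗ[k] H) g (TensorProduct.map LinearMap.id f t) =
      TensorProduct.map LinearMap.id (g ∘ₗ f) t := by
  induction t with
  | zero => simp
  | tmul p q => simp
  | add s t hs ht => simp only [map_add, hs, ht]

end aux

/-- For a bialgebra `H` over a field `k`, the solution `Φ_H` satisfies
`Φ₁₂ ∘ Φ₁₃ = Φ₁₃ ∘ Φ₁₂` if and only if `H` is cocommutative, i.e. `τ ∘ Δ = Δ`. -/
theorem phi_cocommutative_iff_bialgebra_cocommutative
    (k H : Type*) [Field k] [Ring H] [Bialgebra k H] :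
    lmap12 k H (PhiBialg k H) ∘ₗ lmap13 k H (PhiBialg k H) =
        lmap13 k H (PhiBialg k H) ∘ₗ lmap12 k H (PhiBialg k H) ↔
      (TensorProduct.comm k H H).toLinearMap ∘ₗ Coalgebra.comul =
        (Coalgebra.comul : H →ₗ[k] H ⊗[k] H) := by
  constructor
  · intro h
    ext a
    have h1 := LinearMap.congr_fun h (a ⊗ₜ ((1 : H) ⊗ₜ (1 : H)))
    rw [LinearMap.comp_apply, LinearMap.comp_apply, aux_left, aux_right, aux_map_comp,
      aux_map_comp] at h1
    have h2 := congrArg (fun t => TensorProduct.lid k (H ⊗[k] H)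
      (TensorProduct.map (Coalgebra.counit (R := k)) LinearMap.id t)) h1
    simp only [aux_counit] at h2
    have hR : auxR k (1 : H) (1 : H) = LinearMap.id := by
      simp [auxR]
    rw [hR] at h2
    exact h2.symm
  · intro h
    refine TensorProduct.ext' fun a t => ?_
    induction t with
    | zero => simp
    | add s t hs ht => rw [TensorProduct.tmul_add, map_add, map_add, hs, ht]
    | tmul b c =>
      rw [LinearMap.comp_apply, LinearMap.comp_apply, aux_left, aux_right, aux_map_comp,
        aux_map_comp, LinearMap.comp_assoc, h]
end

section
/- Let (B, N, ◁, ▷) be a matched pair of groups. Then the map φ : (B × N) × (B × N) → (B × N) × (B × N) defined by φ((s,u),(t,v)) = ((s·(t ◁ u⁻¹)⁻¹, (t ◁ u⁻¹) ▷ u), (t ◁ u⁻¹, uv)) is a bijective map satisfying the RPE. -/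
/-- Let `(B, N, ◁, ▷)` be a matched pair of groups (here `rd b u = b ◁ u` is a right
action of `N` on `B` and `ld b u = b ▷ u` is a left action of `B` on `N`, satisfying the
matched pair compatibilities).  Then the map
`φ((s,u),(t,v)) = ((s·(t ◁ u⁻¹)⁻¹, (t ◁ u⁻¹) ▷ u), (t ◁ u⁻¹, uv))` is a bijective solution
of the RPE on `B × N`. -/
theorem matched_pair_solution_is_bijective_RPE
    {B N : Type*} [Group B] [Group N]
    (rd : B → N → B) (ld : B → N → N)
    (hrd_mul : ∀ (b : B) (u v : N), rd (rd b u) v = rd b (u * v))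
    (hrd_one : ∀ b : B, rd b 1 = b)
    (hld_mul : ∀ (b b' : B) (u : N), ld (b * b') u = ld b (ld b' u))
    (hld_one : ∀ u : N, ld 1 u = u)
    (hcomp1 : ∀ (b : B) (u v : N), ld b (u * v) = ld b u * ld (rd b u) v)
    (hcomp2 : ∀ (b b' : B) (u : N), rd (b * b') u = rd b (ld b' u) * rd b' u)
    (hld_oneN : ∀ b : B, ld b 1 = 1)
    (hrd_oneB : ∀ u : N, rd 1 u = 1) :
    Function.Bijective
        (fun p : (B × N) × (B × N) =>
          (((p.1.1 * (rd p.2.1 p.1.2⁻¹)⁻¹, ld (rd p.2.1 p.1.2⁻¹) p.1.2),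
            (rd p.2.1 p.1.2⁻¹, p.1.2 * p.2.2)) : (B × N) × (B × N))) ∧
      IsRPE
        (fun p : (B × N) × (B × N) =>
          (((p.1.1 * (rd p.2.1 p.1.2⁻¹)⁻¹, ld (rd p.2.1 p.1.2⁻¹) p.1.2),
            (rd p.2.1 p.1.2⁻¹, p.1.2 * p.2.2)) : (B × N) × (B × N))) := by
  have hinv : ∀ b u, rd (rd b u⁻¹) u = b := fun b u => by rw [hrd_mul, inv_mul_cancel, hrd_one]
  have hinv' : ∀ b u, rd (rd b u) u⁻¹ = b := fun b u => by rw [hrd_mul, mul_inv_cancel, hrd_one]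
  have hl : ∀ b u, ld b⁻¹ (ld b u) = u := fun b u => by rw [← hld_mul, inv_mul_cancel, hld_one]
  have hl' : ∀ b u, ld b (ld b⁻¹ u) = u := fun b u => by rw [← hld_mul, mul_inv_cancel, hld_one]
  constructor
  · rw [Function.bijective_iff_has_inverse]
    refine ⟨fun q => ((q.1.1 * q.2.1, ld q.2.1⁻¹ q.1.2),
      (rd q.2.1 (ld q.2.1⁻¹ q.1.2), (ld q.2.1⁻¹ q.1.2)⁻¹ * q.2.2)), ?_, ?_⟩
    · rintro ⟨⟨s, u⟩, ⟨t, v⟩⟩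
      simp [hl, hinv]
    · rintro ⟨⟨s, u⟩, ⟨t, v⟩⟩
      simp [hl', hinv']
  · unfold IsRPE
    funext ⟨⟨s, u⟩, ⟨t, v⟩, ⟨r, w⟩⟩
    have hc : rd (rd r v⁻¹) u⁻¹ = rd r (u * v)⁻¹ := by rw [hrd_mul, mul_inv_rev]
    have hd : rd (rd r (u * v)⁻¹) u = rd r v⁻¹ := by rw [← hc, hinv]
    have he : rd (t * (rd r v⁻¹)⁻¹) (ld (rd r (u * v)⁻¹) u)⁻¹
        = rd t u⁻¹ * (rd r (u * v)⁻¹)⁻¹ := by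
      have h := hcomp2 (rd t u⁻¹ * (rd r (u * v)⁻¹)⁻¹) (rd r (u * v)⁻¹) u
      rw [inv_mul_cancel_right, hinv, hd] at h
      rw [← eq_mul_inv_iff_mul_eq.mpr h.symm, hinv']
    have hf : ld (rd r (u * v)⁻¹) u * ld (rd r v⁻¹) v = ld (rd r (u * v)⁻¹) (u * v) := by
      rw [hcomp1, hd]
    simp only [pe12, pe13, pe23, Function.comp, hc, he, hf, ← hld_mul, inv_mul_cancel_right,
      mul_assoc, Prod.mk.injEq, true_and, and_true]
    simp
end
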